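/- Let N ≥ 1 and k ≥ 1 be integers, and let f and h be modular forms of weight k on Γ(N). Let σ be a field automorphism of ℂ with σ(ζ_N) = ζ_N^λ for an integer λ coprime to N, fix λ' ∈ ℤ with λλ' ≡ 1 (mod N), and assume a_n(h) = σ(a_n(f)) for all n ≥ 0. Let g = (A, B; C, D) ∈ SL₂(ℤ) and let g_λ ∈ SL₂(ℤ) be any matrix with g_λ ≡ (A, λB; λ'C, D) (mod N). Then for every n ≥ 0 one has a_n(h |_k g_λ) = σ(a_n(f |_k g)); that is, applying σ to the Fourier coefficients of f|_k g yields the Fourier coefficients of h|_k g_λ. -/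

import Mathlib

open Complex UpperHalfPlane CongruenceSubgroup
open scoped ModularForm MatrixGroups Real

noncomputable section

/-- `ζ_N = e^{2πi/N}`. -/
def zetaC (N : ℕ) : ℂ := Complex.exp (2 * Real.pi * Complex.I / N)

/-- `f` has the Fourier expansion `Σ_{n ≥ 0} c n · e^{2πinτ/N}`. -/
def HasExpansion (N : ℕ) (f : ℍ → ℂ) (c : ℕ → ℂ) : Prop :=
  ∀ τ : ℍ, HasSum (fun n : ℕ => c n * Complex.exp (2 * Real.pi * Complex.I * n * (τ : ℂ) / N)) (f τ)

/-- the nome of level `N`. -/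
def qq (N : ℕ) (τ : ℂ) : ℂ := Complex.exp (2 * Real.pi * Complex.I * τ / N)

def HP (N : ℕ) (F : ℍ → ℂ) (p : PowerSeries ℂ) : Prop :=
  ∀ τ : ℍ, HasSum (fun n : ℕ => p.coeff n * qq N τ ^ n) (F τ)

lemma qq_pow (N : ℕ) (τ : ℂ) (n : ℕ) :
    qq N τ ^ n = Complex.exp (2 * Real.pi * Complex.I * n * τ / N) := by
  rw [qq, ← Complex.exp_nat_mul]; congr 1; ring

lemma HP_iff (N : ℕ) (F : ℍ → ℂ) (c : ℕ → ℂ) :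
    HasExpansion N F c ↔ HP N F (PowerSeries.mk c) := by
  simp [HasExpansion, HP, qq_pow]

lemma qq_eq (N : ℕ) (τ : ℂ) : qq N τ = Function.Periodic.qParam (N : ℝ) τ := by
  simp [qq, Function.Periodic.qParam]

lemma HP.congr {N : ℕ} {F G : ℍ → ℂ} {p : PowerSeries ℂ} (h : HP N F p) (hFG : ∀ τ, F τ = G τ) :
    HP N G p := by
  rwa [← show F = G from funext hFG]

lemma HP.add {N : ℕ} {F G : ℍ → ℂ} {p r : PowerSeries ℂ} (h1 : HP N F p) (h2 : HP N G r) :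
    HP N (fun τ => F τ + G τ) (p + r) := fun τ => by
  simpa [add_mul] using (h1 τ).add (h2 τ)

lemma HP.neg {N : ℕ} {F : ℍ → ℂ} {p : PowerSeries ℂ} (h1 : HP N F p) :
    HP N (fun τ => - F τ) (-p) := fun τ => by
  simpa using (h1 τ).neg

lemma HP.sub {N : ℕ} {F G : ℍ → ℂ} {p r : PowerSeries ℂ} (h1 : HP N F p) (h2 : HP N G r) :
    HP N (fun τ => F τ - G τ) (p - r) := fun τ => by
  simpa [sub_mul] using (h1 τ).sub (h2 τ)

lemma HP.const (N : ℕ) (a : ℂ) : HP N (fun _ => a) (PowerSeries.C a) := fun τ => by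
  have := hasSum_ite_eq (0 : ℕ) a
  refine this.congr_fun ?_ |> fun h => h
  intro n
  rw [PowerSeries.coeff_C]
  split_ifs with h <;> simp [h]

lemma HP.mul {N : ℕ} {F G : ℍ → ℂ} {p r : PowerSeries ℂ} (h1 : HP N F p) (h2 : HP N G r) :
    HP N (fun τ => F τ * G τ) (p * r) := fun τ => by
  have a1 := (h1 τ).summable.norm
  have a2 := (h2 τ).summable.norm
  have := tsum_mul_tsum_eq_tsum_sum_antidiagonal_of_summable_norm a1 a2
  have hs := (summable_norm_sum_mul_antidiagonal_of_summable_norm a1 a2).of_norm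
  rw [(h1 τ).tsum_eq, (h2 τ).tsum_eq] at this
  show HasSum _ (F τ * G τ)
  rw [this]
  refine hs.hasSum.congr_fun fun n => ?_
  rw [PowerSeries.coeff_mul, Finset.sum_mul]
  refine Finset.sum_congr rfl fun x hx => ?_
  rw [← Finset.HasAntidiagonal.mem_antidiagonal.mp hx, pow_add]; ring

lemma HP.sum {N : ℕ} {ι : Type*} (s : Finset ι) {F : ι → ℍ → ℂ} {p : ι → PowerSeries ℂ}
    (h : ∀ i ∈ s, HP N (F i) (p i)) : HP N (fun τ => ∑ i ∈ s, F i τ) (∑ i ∈ s, p i) := by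
  classical
  induction s using Finset.induction_on with
  | empty => simpa using HP.const N 0
  | insert a s ha ih =>
    simp only [Finset.sum_insert ha]
    exact (h a (by simp)).add (ih fun i hi => h i (by simp [hi]))

lemma HP.prod {N : ℕ} {ι : Type*} (s : Finset ι) {F : ι → ℍ → ℂ} {p : ι → PowerSeries ℂ}
    (h : ∀ i ∈ s, HP N (F i) (p i)) : HP N (fun τ => ∏ i ∈ s, F i τ) (∏ i ∈ s, p i) := by
  classical
  induction s using Finset.induction_on with
  | empty => simpa using HP.const N 1
  | insert a s ha ih =>
    simp only [Finset.prod_insert ha]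
    exact (h a (by simp)).mul (ih fun i hi => h i (by simp [hi]))

lemma HP.eq_zero {N : ℕ} (hN : 1 ≤ N) {p : PowerSeries ℂ} (h : HP N 0 p) : p = 0 := by
  have hm : (N : ℝ) ∈ (𝒮ℒ).strictPeriods := by
    simp only [Subgroup.strictPeriods_SL2Z]
    exact AddSubgroup.mem_zmultiples_iff.mpr ⟨N, by simp⟩
  ext n
  have := ModularFormClass.qExpansion_coeff_unique (h := (N : ℝ)) (c := fun n => p.coeff n)
    (by exact_mod_cast hN) hm (f := (0 : ModularForm 𝒮ℒ 0))
    (fun τ => by simpa [qq_eq] using h τ) n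
  rw [this]; simp [qExpansion_zero]

lemma HP.unique {N : ℕ} (hN : 1 ≤ N) {F : ℍ → ℂ} {p r : PowerSeries ℂ} (h1 : HP N F p)
    (h2 : HP N F r) : p = r := by
  rw [← sub_eq_zero]
  refine HP.eq_zero hN ((h1.sub h2).congr fun τ => by simp)

lemma HP.fun_unique {N : ℕ} {F G : ℍ → ℂ} {p : PowerSeries ℂ} (h1 : HP N F p)
    (h2 : HP N G p) : F = G := funext fun τ => (h1 τ).unique (h2 τ)

lemma HP.bdd {N : ℕ} (hN : 1 ≤ N) {F : ℍ → ℂ} {p : PowerSeries ℂ} (h : HP N F p) :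
    IsBoundedAtImInfty F :=
  isBoundedAtImInfty_of_hasSum_qExpansion (h := (N : ℝ)) (c := fun n => p.coeff n)
    (by exact_mod_cast hN) (fun τ => by simpa [qq_eq] using h τ)

lemma norm_qq (N : ℕ) (τ : ℂ) : ‖qq N τ‖ = Real.exp (-(2 * π * τ.im / N)) := by
  rw [qq_eq, Function.Periodic.norm_qParam]; congr 1; ring

open Manifold in
lemma HP.mdiff {N : ℕ} {F : ℍ → ℂ} {p : PowerSeries ℂ} (h : HP N F p) :
    MDiff F := by
  rw [UpperHalfPlane.mdifferentiable_iff]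
  intro z hz
  have hz' : 0 < z.im := hz
  refine DifferentiableAt.differentiableWithinAt ?_
  have hopen : IsOpen {w : ℂ | z.im / 2 < w.im} := isOpen_lt continuous_const continuous_im
  have hmem : z ∈ {w : ℂ | z.im / 2 < w.im} := by simp only [Set.mem_ofPred_eq]; linarith
  let τ1 : ℍ := ⟨(z.im / 2 : ℝ) * Complex.I, by simp; linarith⟩
  have key : DifferentiableOn ℂ (fun w => ∑' n : ℕ, p.coeff n * qq N w ^ n)
      {w : ℂ | z.im / 2 < w.im} := by
    refine differentiableOn_tsum_of_summable_norm (h τ1).summable.norm ?_ hopen ?_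
    · intro n
      unfold qq
      fun_prop
    · intro n w hw
      rw [norm_mul, norm_mul, norm_pow, norm_pow, norm_qq, norm_qq]
      have : (τ1 : ℂ).im = z.im / 2 := by simp [τ1]
      rw [this]
      have hw' : z.im / 2 < w.im := hw
      gcongr
  refine ((key.differentiableAt (hopen.mem_nhds hmem))).congr_of_eventuallyEq ?_
  filter_upwards [hopen.mem_nhds hmem] with w hw
  have hw' : 0 < w.im := lt_trans (by linarith) (show z.im / 2 < w.im from hw)
  rw [Function.comp_apply, ← (h (ofComplex w)).tsum_eq, ofComplex_apply_of_im_pos hw']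

/-- two functions have expansions related by `s`. -/
def SRel (N : ℕ) (s : ℂ ≃+* ℂ) (F H : ℍ → ℂ) : Prop :=
  ∃ p : PowerSeries ℂ, HP N F p ∧ HP N H (p.map (s : ℂ →+* ℂ))

section SRel
variable {N : ℕ} {s : ℂ ≃+* ℂ} {F G F' G' : ℍ → ℂ}

lemma SRel.congr (h : SRel N s F F') (h1 : ∀ τ, F τ = G τ) (h2 : ∀ τ, F' τ = G' τ) :
    SRel N s G G' := by
  rwa [← show F = G from funext h1, ← show F' = G' from funext h2]

lemma SRel.add (h : SRel N s F F') (h' : SRel N s G G') :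
    SRel N s (fun τ => F τ + G τ) (fun τ => F' τ + G' τ) := by
  obtain ⟨p, a, b⟩ := h
  obtain ⟨r, c, d⟩ := h'
  exact ⟨p + r, a.add c, by rw [map_add]; exact b.add d⟩

lemma SRel.sub (h : SRel N s F F') (h' : SRel N s G G') :
    SRel N s (fun τ => F τ - G τ) (fun τ => F' τ - G' τ) := by
  obtain ⟨p, a, b⟩ := h
  obtain ⟨r, c, d⟩ := h'
  exact ⟨p - r, a.sub c, by rw [map_sub]; exact b.sub d⟩

lemma SRel.mul (h : SRel N s F F') (h' : SRel N s G G') :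
    SRel N s (fun τ => F τ * G τ) (fun τ => F' τ * G' τ) := by
  obtain ⟨p, a, b⟩ := h
  obtain ⟨r, c, d⟩ := h'
  exact ⟨p * r, a.mul c, by rw [map_mul]; exact b.mul d⟩

lemma SRel.const (a : ℂ) : SRel N s (fun _ => a) (fun _ => s a) :=
  ⟨_, HP.const N a, by simpa using HP.const N (s a)⟩

lemma SRel.sum {ι : Type*} (t : Finset ι) {F F' : ι → ℍ → ℂ}
    (h : ∀ i ∈ t, SRel N s (F i) (F' i)) :
    SRel N s (fun τ => ∑ i ∈ t, F i τ) (fun τ => ∑ i ∈ t, F' i τ) := by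
  classical
  induction t using Finset.induction_on with
  | empty => simpa using SRel.const (N := N) (s := s) 0
  | insert a t ha ih =>
    simp only [Finset.sum_insert ha]
    exact (h a (by simp)).add (ih fun i hi => h i (by simp [hi]))

lemma SRel.prod {ι : Type*} (t : Finset ι) {F F' : ι → ℍ → ℂ}
    (h : ∀ i ∈ t, SRel N s (F i) (F' i)) :
    SRel N s (fun τ => ∏ i ∈ t, F i τ) (fun τ => ∏ i ∈ t, F' i τ) := by
  classical
  induction t using Finset.induction_on with
  | empty => simpa using SRel.const (N := N) (s := s) 1
  | insert a t ha ih =>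
    simp only [Finset.prod_insert ha]
    exact (h a (by simp)).mul (ih fun i hi => h i (by simp [hi]))

lemma SRel.fun_unique (hN : 1 ≤ N) (h : SRel N s F G) (h' : SRel N s F G') : G = G' := by
  obtain ⟨p, a, b⟩ := h
  obtain ⟨r, c, d⟩ := h'
  obtain rfl := a.unique hN c
  exact b.fun_unique d

/-- cancellation -/
lemma SRel.cancel (hN : 1 ≤ N) {D D' H : ℍ → ℂ} {pF pH : PowerSeries ℂ}
    (hF : HP N F pF) (hH : HP N H pH) (hD : SRel N s D D') (hD0 : D ≠ 0)
    (h : SRel N s (fun τ => F τ * D τ) (fun τ => H τ * D' τ)) :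
    pH = pF.map (s : ℂ →+* ℂ) := by
  obtain ⟨d, hd, hd'⟩ := hD
  obtain ⟨r, hr, hr'⟩ := h
  obtain rfl := hr.unique hN (hF.mul hd)
  have e := hr'.unique hN (hH.mul hd')
  rw [map_mul] at e
  have hd0 : d ≠ 0 := by
    rintro rfl
    exact hD0 (hd.fun_unique (by have := HP.const N 0; rw [map_zero] at this; exact this))
  have : d.map (s : ℂ →+* ℂ) ≠ 0 := by
    rw [Ne, map_eq_zero_iff _ (PowerSeries.map_injective _ s.injective)]
    exact hd0
  exact (mul_right_cancel₀ this e).symm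

end SRel

lemma SRel.rescale {N : ℕ} (hN : 1 ≤ N) {s : ℂ ≃+* ℂ} {F F' : ℍ → ℂ} (h : SRel 1 s F F') :
    SRel N s F F' := by
  obtain ⟨p, hp, hp'⟩ := h
  have key : ∀ (G : ℍ → ℂ) (r : PowerSeries ℂ), HP 1 G r →
      HP N G (PowerSeries.mk fun n => if N ∣ n then r.coeff (n / N) else 0) := by
    intro G r hr τ
    have hinj : Function.Injective (fun n : ℕ => n * N) := fun a b hab =>
      Nat.eq_of_mul_eq_mul_right (by omega) hab
    rw [← hinj.hasSum_iff]
    · refine (hr τ).congr_fun fun n => ?_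
      have hN' : (N : ℂ) ≠ 0 := by
        have : N ≠ 0 := by omega
        exact_mod_cast this
      simp only [Function.comp_apply, PowerSeries.coeff_mk, dvd_mul_left, if_true]
      rw [Nat.mul_div_cancel _ (by omega), qq_pow, qq_pow]
      congr 2
      push_cast
      field_simp
    · intro n hn
      have : ¬ N ∣ n := by
        rintro ⟨m, rfl⟩
        exact hn ⟨m, by simp [mul_comm]⟩
      simp [this]
  refine ⟨_, key F p hp, ?_⟩
  convert key F' _ hp' using 1
  ext n
  simp only [PowerSeries.coeff_map, PowerSeries.coeff_mk]
  split_ifs <;> simp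

lemma HP_level_one {k : ℤ} (g : ModularForm 𝒮ℒ k) : HP 1 g (qExpansion 1 g) := fun τ => by
  have := ModularForm.hasSum_qExpansion (h := 1) g one_pos one_mem_strictPeriods_SL τ
  simpa [qq_eq] using this

lemma SRel_E {s : ℂ ≃+* ℂ} {k : ℕ} (hk : 3 ≤ k) (hk2 : Even k) :
    SRel 1 s (ModularForm.E hk) (ModularForm.E hk) := by
  refine ⟨_, HP_level_one _, ?_⟩
  convert HP_level_one (ModularForm.E hk) using 1
  ext n
  rw [PowerSeries.coeff_map, EisensteinSeries.E_qExpansion_coeff hk hk2]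
  have h2 : s 2 = 2 := map_ofNat s 2
  split_ifs <;> simp [h2]

lemma SRel_Delta {s : ℂ ≃+* ℂ} :
    SRel 1 s ModularForm.discriminant ModularForm.discriminant := by
  have h4 : SRel 1 s ModularForm.E₄ ModularForm.E₄ := SRel_E (by norm_num) ⟨2, rfl⟩
  have h6 : SRel 1 s ModularForm.E₆ ModularForm.E₆ := SRel_E (by norm_num) ⟨3, rfl⟩
  have h := ((h4.mul (h4.mul h4)).sub (h6.mul h6)).mul (SRel.const (1728⁻¹ : ℂ))
  refine h.congr (fun τ => ?_) (fun τ => ?_) <;>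
  · rw [ModularForm.discriminant_eq_E₄_cube_sub_E₆_sq]
    have h2 : s 1728 = 1728 := map_ofNat s 1728
    try simp only [map_inv₀, h2]
    ring

lemma SRel_level_one (s : ℂ ≃+* ℂ) (n : ℕ) : ∀ (k : ℤ), k < n → ∀ g : ModularForm 𝒮ℒ k,
    ∃ g' : ModularForm 𝒮ℒ k, SRel 1 s g g' := by
  have hzero : ∀ (k : ℤ) (g : ModularForm 𝒮ℒ k), (∀ τ, g τ = 0) →
      ∃ g' : ModularForm 𝒮ℒ k, SRel 1 s g g' := by
    intro k g hg
    refine ⟨0, (SRel.const 0).congr (fun τ => (hg τ).symm) (fun τ => ?_)⟩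
    simp
  induction n with
  | zero =>
    intro k hk g
    exact hzero k g fun τ => by
      rw [ModularFormClass.levelOne_neg_weight_eq_zero (by simpa using hk) g]; rfl
  | succ n ih =>
    intro k hk g
    rcases lt_or_ge k 0 with hk0 | hk0
    · exact hzero k g fun τ => by
        rw [ModularFormClass.levelOne_neg_weight_eq_zero hk0 g]; rfl
    rcases Int.even_or_odd k with hev | hodd
    swap
    · exact hzero k g fun τ => by
        rw [ModularForm.levelOne_odd_weight_eq_zero hodd g]; rfl
    rcases eq_or_ne k 0 with rfl | hk00
    · obtain ⟨c, hc⟩ := ModularFormClass.levelOne_weight_zero_const g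
      refine ⟨ModularForm.const (s c), (SRel.const c).congr (fun τ => ?_) (fun τ => ?_)⟩
      · rw [hc]; rfl
      · rfl
    rcases eq_or_ne k 2 with rfl | hk2
    · have := ModularForm.levelOne_weight_two_rank_zero
      rw [rank_zero_iff] at this
      exact hzero 2 g fun τ => by
        rw [Subsingleton.elim g 0]; rfl
    lift k to ℕ using hk0
    have hk3 : 3 ≤ k := by
      rcases hev with ⟨m, hm⟩
      omega
    have hev' : Even k := by exact_mod_cast hev
    have hE := ModularForm.sub_smul_isCuspForm g (ModularForm.E hk3)
      (EisensteinSeries.E_qExpansion_coeff_zero hk3 hev')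
    set a := (qExpansion 1 g).coeff 0
    obtain ⟨u, hu⟩ := hE
    have hu' : ∀ τ, u τ = g τ - a * ModularForm.E hk3 τ := fun τ => by
      have := congrArg (fun F : ModularForm 𝒮ℒ k => F τ) hu
      simpa using this
    obtain ⟨v, hv⟩ := ih ((k : ℤ) - 12) (by push_cast at hk; linarith) (CuspForm.discriminantEquiv u)
    refine ⟨(CuspForm.toModularFormₗ (CuspForm.ofMulDiscriminant v) : ModularForm 𝒮ℒ k) +
      s a • ModularForm.E hk3, ?_⟩
    refine ((SRel_Delta.mul hv).add ((SRel.const a).mul (SRel_E hk3 hev'))).congr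
      (fun τ => ?_) (fun τ => ?_)
    · rw [ModularForm.discriminant_mul_discriminantEquiv_apply, hu']; ring
    · simp

lemma SRel_level_one' {N : ℕ} (hN : 1 ≤ N) (s : ℂ ≃+* ℂ) {k : ℤ} (g : ModularForm 𝒮ℒ k) :
    ∃ g' : ModularForm 𝒮ℒ k, SRel N s g g' := by
  obtain ⟨g', h⟩ := SRel_level_one s (k.toNat + 1) k (by push_cast; have := Int.self_le_toNat k; linarith) g
  exact ⟨g', h.rescale hN⟩

section Eis
open EisensteinSeries

lemma qq_norm_lt {N : ℕ} (hN : 1 ≤ N) (z : ℍ) : ‖qq N z‖ < 1 := by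
  rw [norm_qq]
  have := z.im_pos
  have : (0 : ℝ) < N := by exact_mod_cast hN
  simp only [UpperHalfPlane.coe_im, Real.exp_lt_one_iff, Left.neg_neg_iff]
  positivity

/-- The additive character. -/
def chi (N : ℕ) [NeZero N] (b : ZMod N) : ℂ := ZMod.stdAddChar b

lemma chi_add (N : ℕ) [NeZero N] (a b : ZMod N) : chi N (a + b) = chi N a * chi N b :=
  AddChar.map_add_eq_mul _ _ _

lemma chi_norm (N : ℕ) [NeZero N] (b : ZMod N) : ‖chi N b‖ = 1 := by
  simp [chi]

lemma chi_nsmul (N : ℕ) [NeZero N] (b : ZMod N) (d : ℕ) : chi N (d * b) = chi N b ^ d := by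
  rw [← nsmul_eq_mul]; exact AddChar.map_nsmul_eq_pow _ _ _

lemma chi_int (N : ℕ) [NeZero N] (n : ℤ) : chi N n = Complex.exp (2 * π * Complex.I * n / N) :=
  ZMod.stdAddChar_coe n

lemma chi_inj (N : ℕ) [NeZero N] {a b : ZMod N} (h : chi N a = chi N b) : a = b :=
  ZMod.injective_stdAddChar h

lemma chi_sum (N : ℕ) [NeZero N] (b : ZMod N) :
    ∑ x : ZMod N, chi N (x * b) = if b = 0 then (N : ℂ) else 0 := by
  have := AddChar.sum_mulShift b (ZMod.isPrimitive_stdAddChar N)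
  simpa [chi] using this

lemma innerSum (N : ℕ) [NeZero N] {k : ℕ} (hk : 2 ≤ k) (b : ZMod N) (z : ℍ) :
    ∑' n : ℤ, (if (n : ZMod N) = b then 1 / ((z : ℂ) + n) ^ k else 0) =
    ((-2 * π * Complex.I) ^ k / (N ^ k * (k - 1).factorial)) *
      ∑' d : ℕ+, chi N ((d : ℕ) * b) * ((d : ℕ) : ℂ) ^ (k - 1) * qq N z ^ (d : ℕ) := by
  have hN0 : (N : ℂ) ≠ 0 := by exact_mod_cast NeZero.ne N
  have hNr : (0 : ℝ) < N := by exact_mod_cast Nat.pos_of_neZero N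
  have hNz : (N : ℤ) ≠ 0 := by exact_mod_cast NeZero.ne N
  let φ : ℤ → ℤ := fun j => b.val + N * j
  have hφ : Function.Injective φ := fun i j h => by
    have h' : (N : ℤ) * i = N * j := by simp only [φ] at h; linarith
    exact mul_left_cancel₀ hNz h'
  rw [← hφ.tsum_eq (f := fun n : ℤ => (if (n : ZMod N) = b then 1 / ((z : ℂ) + n) ^ k else 0))]
  swap
  · intro n hn
    simp only [Function.mem_support, ne_eq, ite_eq_right_iff, Classical.not_imp] at hn
    have h1 : ((n - b.val : ℤ) : ZMod N) = 0 := by simp [hn.1]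
    obtain ⟨j, hj⟩ := (ZMod.intCast_zmod_eq_zero_iff_dvd _ _).mp h1 |> fun h => h
    exact ⟨j, by simp only [φ]; linarith⟩
  let w : ℍ := ⟨((z : ℂ) + b.val) / N, by
    have := z.im_pos
    rw [Complex.div_natCast_im]
    simp only [add_im, coe_im, natCast_im, add_zero]
    positivity⟩
  have H := qExpansion_identity_pnat (k := k - 1) (by omega) w
  rw [show k - 1 + 1 = k by omega] at H
  have e1 : ∀ j : ℤ, (if ((φ j : ℤ) : ZMod N) = b then 1 / ((z : ℂ) + (φ j : ℤ)) ^ k else 0)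
      = (1 / (N : ℂ) ^ k) * (1 / ((w : ℂ) + j) ^ k) := fun j => by
    have : ((φ j : ℤ) : ZMod N) = b := by simp [φ]
    rw [if_pos this, div_mul_div_comm, one_mul, ← mul_pow]
    congr 2
    show _ = (N : ℂ) * (((z : ℂ) + b.val) / N + j)
    simp only [φ]; push_cast; field_simp; ring
  simp_rw [e1]
  rw [tsum_mul_left, H, ← mul_assoc]
  congr 1
  · field_simp
  · refine tsum_congr fun d => ?_
    have : Complex.exp (2 * π * Complex.I * (w : ℂ)) = chi N b * qq N z := by
      have hb : chi N b = chi N ((b.val : ℤ) : ZMod N) := by simp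
      rw [hb, chi_int, qq, ← Complex.exp_add]
      congr 1
      show 2 * π * Complex.I * (((z : ℂ) + b.val) / N) = _
      push_cast; field_simp; ring
    rw [this, mul_pow, chi_nsmul]
    ring

lemma doubleSum {u : ℕ → ℕ → ℂ} {M : ℝ} (hu : ∀ m d, ‖u m d‖ ≤ M) (K : ℕ) {r : ℂ} (hr : ‖r‖ < 1) :
    (Summable fun c : ℕ+ × ℕ+ => u c.1 c.2 * ((c.2 : ℕ) : ℂ) ^ K * r ^ (c.1 * c.2 : ℕ)) ∧
    HasSum (fun n : ℕ+ => (∑ x ∈ (n : ℕ).divisorsAntidiagonal, u x.1 x.2 * (x.2 : ℂ) ^ K)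
      * r ^ (n : ℕ))
    (∑' m : ℕ+, ∑' d : ℕ+, u m d * ((d : ℕ) : ℂ) ^ K * r ^ (m * d : ℕ)) := by
  have hs : Summable fun c : ℕ+ × ℕ+ =>
      u c.1 c.2 * ((c.2 : ℕ) : ℂ) ^ K * r ^ (c.1 * c.2 : ℕ) := by
    refine Summable.of_norm_bounded ((summable_prod_mul_pow K hr).norm.mul_left M) fun c => ?_
    rw [mul_assoc, norm_mul]
    exact mul_le_mul_of_nonneg_right (hu _ _) (norm_nonneg _)
  refine ⟨hs, ?_⟩
  rw [← hs.tsum_prod]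
  have h2 := hs.hasSum
  rw [← sigmaAntidiagonalEquivProd.hasSum_iff] at h2
  refine (h2.sigma fun n => hasSum_fintype _).congr_fun fun n => ?_
  simp only [Function.comp]
  rw [Finset.sum_mul]
  rw [← Finset.sum_coe_sort]
  refine Finset.sum_congr rfl fun x _ => ?_
  have := (Nat.mem_divisorsAntidiagonal.mp x.2).1
  simp only [sigmaAntidiagonalEquivProd, divisorsAntidiagonalFactors, Equiv.coe_fn_mk, PNat.mk_coe]
  rw [this]

/-- Constant term. -/
def T0 (N : ℕ) [NeZero N] (k : ℕ) (b : ZMod N) : ℂ :=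
  -(1 / (k.factorial * N : ℂ)) *
    ∑ x : ZMod N, chi N (x * (-b)) * (((Polynomial.bernoulli k).eval ((x.val : ℚ) / N) : ℚ) : ℂ)

lemma bern_eq (k : ℕ) (q : ℚ) :
    (bernoulliFun k (q : ℝ) : ℂ) = (((Polynomial.bernoulli k).eval q : ℚ) : ℂ) := by
  have : bernoulliFun k (q : ℝ) = (((Polynomial.bernoulli k).eval q : ℚ) : ℝ) := by
    rw [bernoulliFun]
    have := Polynomial.eval_map_apply (f := algebraMap ℚ ℝ) (p := Polynomial.bernoulli k) q
    simpa using this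
  rw [this]; norm_cast

lemma constSum (N : ℕ) [NeZero N] {k : ℕ} (hk : 2 ≤ k) (b : ZMod N) :
    ∑' n : ℤ, (if (n : ZMod N) = b then 1 / (n : ℂ) ^ k else 0) =
    (2 * π * Complex.I) ^ k * T0 N k b := by
  have hN0 : (N : ℂ) ≠ 0 := by exact_mod_cast NeZero.ne N
  have hNr : (0 : ℝ) < N := by exact_mod_cast Nat.pos_of_neZero N
  have key : ∀ x : ZMod N, HasSum (fun n : ℤ => chi N (x * (-b)) * (1 / (n : ℂ) ^ k * chi N (x * n)))
      (chi N (x * (-b)) * (-(2 * π * Complex.I) ^ k / k.factorial *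
        (((Polynomial.bernoulli k).eval ((x.val : ℚ) / N) : ℚ) : ℂ))) := fun x => by
    refine HasSum.mul_left _ ?_
    have hx : (((x.val : ℚ) / N : ℚ) : ℝ) ∈ Set.Icc (0 : ℝ) 1 := by
      have : (x.val : ℝ) ≤ N := by exact_mod_cast (ZMod.val_lt x).le
      push_cast
      exact ⟨by positivity, by rw [div_le_one hNr]; exact this⟩
    have := hasSum_one_div_pow_mul_fourier_mul_bernoulliFun hk hx
    rw [bern_eq] at this
    refine this.congr_fun fun n => ?_
    congr 1
    rw [fourier_coe_apply, show x * n = ((x.val * n : ℤ) : ZMod N) by simp, chi_int]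
    congr 1
    push_cast; field_simp
  have := hasSum_sum (s := Finset.univ) fun x (_ : x ∈ Finset.univ) => key x
  have h2 : HasSum (fun n : ℤ => (N : ℂ) * (if (n : ZMod N) = b then 1 / (n : ℂ) ^ k else 0))
      (∑ x : ZMod N, chi N (x * (-b)) * (-(2 * π * Complex.I) ^ k / k.factorial *
        (((Polynomial.bernoulli k).eval ((x.val : ℚ) / N) : ℚ) : ℂ))) := by
    refine this.congr_fun fun n => ?_
    have : ∀ x : ZMod N, chi N (x * (-b)) * (1 / (n : ℂ) ^ k * chi N (x * n)) =
        1 / (n : ℂ) ^ k * chi N (x * (n - b)) := fun x => by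
      rw [show x * (n - b) = x * (-b) + x * n by ring, chi_add]; ring
    simp_rw [this]
    rw [← Finset.mul_sum, chi_sum]
    simp only [sub_eq_zero]
    split_ifs <;> ring
  have h3 := h2.tsum_eq
  rw [tsum_mul_left] at h3
  rw [← mul_right_inj' hN0, h3, T0, Finset.mul_sum, Finset.mul_sum, Finset.mul_sum]
  refine Finset.sum_congr rfl fun x _ => ?_
  field_simp

/-- Reduction of a vector modulo `N`. -/
def redv (N : ℕ) (x : Fin 2 → ℤ) : Fin 2 → ZMod N := fun i => (x i : ZMod N)

/-- Normalised Eisenstein series. -/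
def WW (N : ℕ) (k : ℕ) (v : Fin 2 → ZMod N) (τ : ℍ) : ℂ :=
  ((2 * π * Complex.I) ^ k)⁻¹ *
    ∑' x : Fin 2 → ℤ, (if redv N x = v then eisSummand k x τ else 0)

/-- Coefficients. -/
def uu (N : ℕ) [NeZero N] (k : ℕ) (a b : ZMod N) (m d : ℕ) : ℂ :=
  (if (m : ZMod N) = a then chi N (d * b) else 0) +
    (-1) ^ k * (if (m : ZMod N) = -a then chi N (d * (-b)) else 0)

def ee (N : ℕ) [NeZero N] (k : ℕ) (a b : ZMod N) (n : ℕ) : ℂ :=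
  if n = 0 then (if a = 0 then T0 N k b else 0) else
    ((-1) ^ k / (N ^ k * (k - 1).factorial)) *
      ∑ x ∈ n.divisorsAntidiagonal, uu N k a b x.1 x.2 * (x.2 : ℂ) ^ (k - 1)

lemma WW_HP (N : ℕ) [NeZero N] {k : ℕ} (hk : 3 ≤ k) (v : Fin 2 → ZMod N) :
    HP N (WW N k v) (PowerSeries.mk (ee N k (v 0) (v 1))) := by
  intro τ
  have hN1 : 1 ≤ N := Nat.pos_of_neZero N
  set a := v 0
  set b := v 1
  have hpi : (2 * π * Complex.I : ℂ) ^ k ≠ 0 := pow_ne_zero _ Complex.two_pi_I_ne_zero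
  -- the double sum
  let F : ℤ × ℤ → ℂ := fun x => if redv N ![x.1, x.2] = v then eisSummand k ![x.1, x.2] τ else 0
  have hFs : Summable F := by
    refine Summable.of_norm_bounded (summable_prod_eisSummand hk τ).norm fun x => ?_
    simp only [F]; split_ifs <;> simp
  have hG : ∑' x : Fin 2 → ℤ, (if redv N x = v then eisSummand k x τ else 0) = ∑' x, F x := by
    rw [← (finTwoArrowEquiv ℤ).symm.tsum_eq]; rfl
  have hFv : ∀ m n : ℤ, F (m, n) = if (m : ZMod N) = a then
      (if (n : ZMod N) = b then 1 / ((m : ℂ) * τ + n) ^ k else 0) else 0 := fun m n => by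
    have : redv N ![m, n] = v ↔ (m : ZMod N) = a ∧ (n : ZMod N) = b := by
      rw [funext_iff, Fin.forall_fin_two]; simp [redv, a, b]
    simp only [F, this, eisSummand]
    by_cases h1 : (m : ZMod N) = a <;> by_cases h2 : (n : ZMod N) = b <;> simp [h1, h2]
  let R : ℕ+ → ℂ := fun m => ∑' d : ℕ+, uu N k a b m d * ((d : ℕ) : ℂ) ^ (k - 1) * qq N τ ^ (m * d : ℕ)
  let c : ℂ := (2 * π * Complex.I) ^ k * ((-1) ^ k / (N ^ k * (k - 1).factorial))
  have hc : c = (-2 * π * Complex.I) ^ k / (N ^ k * (k - 1).factorial) := by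
    simp only [c]; rw [show (-2 * π * Complex.I : ℂ) = (-1) * (2 * π * Complex.I) by ring, mul_pow (-1)]; exact (mul_div_assoc' _ _ _).trans (by rw [mul_comm ((2 * π * Complex.I : ℂ) ^ k)])
  have hsum1 : ∀ (m : ℕ+) (b : ZMod N), Summable fun d : ℕ+ =>
      chi N ((d : ℕ) * b) * ((d : ℕ) : ℂ) ^ (k - 1) * qq N τ ^ (m * d : ℕ) := fun m b =>
    (doubleSum (u := fun m d => chi N (d * b)) (M := 1) (fun m d => (chi_norm _ _).le) (k - 1)
      (qq_norm_lt hN1 τ)).1.prod_factor m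
  have hin : ∀ (m : ℕ+) (b : ZMod N), ∑' n : ℤ, (if (n : ZMod N) = b then
      1 / ((m : ℂ) * τ + n) ^ k else 0) = c * ∑' d : ℕ+, chi N ((d : ℕ) * b) *
        ((d : ℕ) : ℂ) ^ (k - 1) * qq N τ ^ (m * d : ℕ) := fun m b => by
    have := innerSum N (k := k) (by omega) b ⟨(m : ℕ) * τ, by
      have := τ.im_pos
      simp; exact this⟩
    rw [hc]
    convert this using 5 with d
    rw [pow_mul]
    congr 1
    rw [qq_pow, qq]; congr 1
    simp; ring
  have hrow : ∀ m : ℕ+, ∑' n : ℤ, F ((m : ℕ), n) + ∑' n : ℤ, F (-(m : ℕ), n) = c * R m := fun m => by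
    have h1 : ∑' n : ℤ, F ((m : ℕ), n) = c * ∑' d : ℕ+, (if ((m : ℕ) : ZMod N) = a then
        chi N ((d : ℕ) * b) else 0) * ((d : ℕ) : ℂ) ^ (k - 1) * qq N τ ^ (m * d : ℕ) := by
      simp_rw [hFv]
      by_cases h : ((m : ℕ) : ZMod N) = a
      · simp only [Int.cast_natCast, h, if_true]
        exact hin m b
      · simp [h]
    have h2 : ∑' n : ℤ, F (-(m : ℕ), n) = c * ∑' d : ℕ+, (-1) ^ k * (if ((m : ℕ) : ZMod N) = -a then
        chi N ((d : ℕ) * (-b)) else 0) * ((d : ℕ) : ℂ) ^ (k - 1) * qq N τ ^ (m * d : ℕ) := by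
      simp_rw [hFv]
      by_cases h : ((m : ℕ) : ZMod N) = -a
      · have h' : ((-(m : ℕ) : ℤ) : ZMod N) = a := by push_cast; rw [h]; simp
        simp only [h', h, if_true]
        rw [← tsum_comp_neg]
        have : ∀ n : ℤ, (if ((-n : ℤ) : ZMod N) = b then
            1 / (((-(m : ℕ) : ℤ) : ℂ) * τ + (-n : ℤ)) ^ k else 0) =
            (-1) ^ k * (if (n : ZMod N) = -b then 1 / ((m : ℂ) * τ + n) ^ k else 0) := fun n => by
          have e : (((-n : ℤ) : ZMod N) = b) ↔ ((n : ZMod N) = -b) := by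
            push_cast; exact neg_eq_iff_eq_neg
          simp only [e]
          split_ifs
          · rw [show (((-(m : ℕ) : ℤ) : ℂ) * τ + (-n : ℤ)) = (-1) * ((m : ℂ) * τ + n) by
              push_cast; ring, mul_pow]
            rcases neg_one_pow_eq_or ℂ k with h | h <;> rw [h]
            · simp
            · rw [neg_one_mul, neg_one_mul, div_neg]
          · simp
        simp_rw [this]
        rw [tsum_mul_left, hin m (-b)]
        simp_rw [mul_assoc ((-1 : ℂ) ^ k)]
        rw [tsum_mul_left]; ring
      · have h' : ¬ ((-(m : ℕ) : ℤ) : ZMod N) = a := by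
          push_cast; rw [neg_eq_iff_eq_neg]; exact h
        simp only [h', h, if_false]; simp
    rw [h1, h2, ← mul_add, ← Summable.tsum_add]
    · congr 1
      refine tsum_congr fun d => ?_
      simp only [uu]; ring
    · split_ifs
      · exact hsum1 m b
      · simp
    · split_ifs
      · simp_rw [mul_assoc ((-1 : ℂ) ^ k)]
        exact (hsum1 m (-b)).mul_left _
      · simp
  have hu : ∀ m d, ‖uu N k a b m d‖ ≤ 2 := fun m d => by
    have h1 : ‖(if (m : ZMod N) = a then chi N (d * b) else 0)‖ ≤ 1 := by
      split_ifs
      · exact (chi_norm _ _).le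
      · simp
    have h2 : ‖(-1) ^ k * (if (m : ZMod N) = -a then chi N (d * (-b)) else 0)‖ ≤ 1 := by
      rw [norm_mul, norm_pow]
      split_ifs
      · rw [chi_norm]; simp
      · simp
    calc _ ≤ _ := norm_add_le _ _
      _ ≤ 2 := by linarith
  have hD := (doubleSum hu (k - 1) (qq_norm_lt hN1 τ)).2
  have hzero : ∑' n : ℤ, F (0, n) = (2 * π * Complex.I) ^ k * (if a = 0 then T0 N k b else 0) := by
    simp_rw [hFv]
    by_cases h : a = 0
    · simp only [h, Int.cast_zero, if_true, zero_mul, zero_add]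
      exact constSum N (by omega) b
    · simp [h, Ne.symm h]
  have htot : WW N k v τ = (if a = 0 then T0 N k b else 0) +
      ((-1) ^ k / (N ^ k * (k - 1).factorial)) * ∑' m : ℕ+, R m := by
    rw [WW, hG, hFs.tsum_prod, tsum_int_eq_zero_add_tsum_pnat hFs.prod, hzero]
    have s1 : Summable fun m : ℕ+ => ∑' n : ℤ, F (((m : ℕ) : ℤ), n) :=
      hFs.prod.comp_injective (i := fun m : ℕ+ => ((m : ℕ) : ℤ)) fun x y h => by simpa using h
    have s2 : Summable fun m : ℕ+ => ∑' n : ℤ, F (-((m : ℕ) : ℤ), n) :=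
      hFs.prod.comp_injective (i := fun m : ℕ+ => -((m : ℕ) : ℤ)) fun x y h => by simpa using h
    have h3 : ∑' m : ℕ+, ∑' n : ℤ, F (((m : ℕ) : ℤ), n) + ∑' m : ℕ+, ∑' n : ℤ, F (-((m : ℕ) : ℤ), n)
        = c * ∑' m, R m := by
      rw [← s1.tsum_add s2, ← tsum_mul_left]
      exact tsum_congr hrow
    rw [add_assoc]
    erw [h3]
    simp only [c]
    field_simp
  rw [htot, add_comm]
  have h0 : (if a = 0 then T0 N k b else 0) =
      (fun n : ℕ => (PowerSeries.mk (ee N k a b)).coeff n * qq N τ ^ n) 0 := by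
    simp [ee]
  rw [h0]
  rw [← hasSum_pnat_iff]
  refine (hD.mul_left _).congr_fun fun n => ?_
  simp only [PowerSeries.coeff_mk, ee, n.ne_zero, if_false]
  ring

/-- Reduction homomorphism. -/
def rho (N : ℕ) : SL(2, ℤ) →* SL(2, ZMod N) :=
  Matrix.SpecialLinearGroup.map (Int.castRingHom (ZMod N))

lemma redv_vecMul (N : ℕ) (x : Fin 2 → ℤ) (γ : SL(2, ℤ)) :
    redv N (Matrix.vecMul x γ.1) = Matrix.vecMul (redv N x) (rho N γ).1 := by
  have := RingHom.map_vecMul (Int.castRingHom (ZMod N)) γ.1 x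
  funext i
  exact this i

lemma vecMul_inj {R : Type*} [CommRing R] (γ : SL(2, R)) {v w : Fin 2 → R}
    (h : Matrix.vecMul v γ.1 = Matrix.vecMul w γ.1) : v = w := by
  have := congrArg (fun u => Matrix.vecMul u (γ⁻¹).1) h
  simpa [Matrix.vecMul_vecMul, ← Matrix.SpecialLinearGroup.coe_mul, -Matrix.SpecialLinearGroup.coe_inv] using this

lemma WW_smul (N k : ℕ) (v : Fin 2 → ZMod N) (γ : SL(2, ℤ)) (τ : ℍ) :
    WW N k v (γ • τ) = denom γ τ ^ k * WW N k (Matrix.vecMul v (rho N γ).1) τ := by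
  let e : (Fin 2 → ℤ) ≃ (Fin 2 → ℤ) :=
    { toFun := fun x => Matrix.vecMul x γ.1
      invFun := fun x => Matrix.vecMul x (γ⁻¹).1
      left_inv := fun x => by
        show Matrix.vecMul (Matrix.vecMul x γ.1) (γ⁻¹).1 = x
        rw [Matrix.vecMul_vecMul]
        erw [← Matrix.SpecialLinearGroup.coe_mul]
        simp
      right_inv := fun x => by
        show Matrix.vecMul (Matrix.vecMul x (γ⁻¹).1) γ.1 = x
        rw [Matrix.vecMul_vecMul]
        erw [← Matrix.SpecialLinearGroup.coe_mul]
        simp }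
  rw [WW, WW, ← e.tsum_eq (fun x : Fin 2 → ℤ =>
    if redv N x = Matrix.vecMul v (rho N γ).1 then eisSummand k x τ else 0)]
  rw [mul_left_comm, ← tsum_mul_left (a := denom γ τ ^ k)]
  congr 1
  refine tsum_congr fun x => ?_
  have h : redv N (e x) = Matrix.vecMul v (rho N γ).1 ↔ redv N x = v := by
    show redv N (Matrix.vecMul x γ.1) = _ ↔ _
    rw [redv_vecMul]
    exact ⟨fun h => vecMul_inj _ h, fun h => by rw [h]⟩
  simp only [h]
  split_ifs
  · rw [eisSummand_SL2_apply]; simp [e]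
  · simp

lemma chi_zeta (N : ℕ) [NeZero N] (n : ℤ) : chi N n = zetaC N ^ n := by
  rw [chi_int, zetaC, ← Complex.exp_int_mul]; congr 1; ring

lemma sigma_chi (N : ℕ) [NeZero N] {s : ℂ ≃+* ℂ} {l : ℤ} (hs : s (zetaC N) = zetaC N ^ l)
    (b : ZMod N) : s (chi N b) = chi N (l * b) := by
  rw [show b = ((b.val : ℤ) : ZMod N) by simp, chi_zeta, ← Int.cast_mul, chi_zeta, map_zpow₀, hs,
    zpow_mul]

lemma sigma_T0 (N : ℕ) [NeZero N] {s : ℂ ≃+* ℂ} {l : ℤ} (hs : s (zetaC N) = zetaC N ^ l)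
    (k : ℕ) (b : ZMod N) : s (T0 N k b) = T0 N k (l * b) := by
  simp only [T0, map_mul, map_neg, map_div₀, map_one, map_natCast, map_sum, map_ratCast,
    sigma_chi N hs]
  congr 1
  refine Finset.sum_congr rfl fun x _ => ?_
  congr 2; ring

lemma sigma_ee (N : ℕ) [NeZero N] {s : ℂ ≃+* ℂ} {l : ℤ} (hs : s (zetaC N) = zetaC N ^ l)
    (k : ℕ) (a b : ZMod N) (n : ℕ) : s (ee N k a b n) = ee N k a (l * b) n := by
  have h1 : ∀ x : ZMod N, (l : ZMod N) * (x * b) = x * (l * b) := fun x => by ring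
  have h2 : ∀ x : ZMod N, (l : ZMod N) * (x * -b) = x * -(l * b) := fun x => by ring
  simp only [ee, uu, apply_ite s, map_mul, map_neg, map_div₀, map_one, map_natCast, map_sum,
    map_pow, map_add, map_zero, sigma_chi N hs, sigma_T0 N hs, h1, h2]

lemma WW_SRel (N : ℕ) [NeZero N] {s : ℂ ≃+* ℂ} {l : ℤ} (hs : s (zetaC N) = zetaC N ^ l)
    {k : ℕ} (hk : 3 ≤ k) (v : Fin 2 → ZMod N) :
    SRel N s (WW N k v) (WW N k ![v 0, l * v 1]) := by
  refine ⟨_, WW_HP N hk v, ?_⟩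
  convert WW_HP N hk ![v 0, l * v 1] using 1
  ext n
  simp [sigma_ee N hs]

lemma WW_sep (N : ℕ) [NeZero N] {v w : Fin 2 → ZMod N} (hv : v 0 = 1)
    (h3 : WW N 3 v = WW N 3 w) (h4 : WW N 4 v = WW N 4 w) : v = w := by
  have hN1 : 1 ≤ N := Nat.pos_of_neZero N
  have hN0 : (N : ℂ) ≠ 0 := by exact_mod_cast NeZero.ne N
  have key : ∀ k : ℕ, 3 ≤ k → WW N k v = WW N k w →
      uu N k (v 0) (v 1) 1 1 = uu N k (w 0) (w 1) 1 1 := fun k hk h => by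
    have h1 := WW_HP N hk v
    rw [h] at h1
    have h2 := congrArg (PowerSeries.coeff 1) (h1.unique hN1 (WW_HP N hk w))
    simp only [PowerSeries.coeff_mk, ee, one_ne_zero, if_false, Nat.divisorsAntidiagonal_one,
      Finset.sum_singleton, Nat.cast_one, one_pow, mul_one] at h2
    refine mul_left_cancel₀ ?_ h2
    refine div_ne_zero (pow_ne_zero _ (by norm_num)) (mul_ne_zero (pow_ne_zero _ hN0) ?_)
    exact_mod_cast Nat.factorial_ne_zero _
  have e3 := key 3 le_rfl h3
  have e4 := key 4 (by norm_num) h4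
  simp only [uu, Nat.cast_one, one_mul] at e3 e4
  have e : (if 1 = v 0 then chi N (v 1) else 0) = (if 1 = w 0 then chi N (w 1) else 0) := by
    rw [show (-1 : ℂ) ^ 3 = -1 by norm_num] at e3
    rw [show (-1 : ℂ) ^ 4 = 1 by norm_num] at e4
    linear_combination (e3 + e4) / 2
  rw [if_pos hv.symm] at e
  have hne : chi N (v 1) ≠ 0 := fun h => by have := chi_norm N (v 1); rw [h] at this; simp at this
  have hw : 1 = w 0 := by
    by_contra hw
    rw [if_neg hw] at e
    exact hne e
  rw [if_pos hw] at e
  funext i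
  fin_cases i
  · exact hv.trans hw
  · exact chi_inj N e

lemma WW_sep' (N : ℕ) [NeZero N] (γ : SL(2, ZMod N)) (hγ : γ ≠ 1) :
    ∃ p : (Fin 2 → ZMod N) × ℕ, 3 ≤ p.2 ∧ WW N p.2 p.1 ≠ WW N p.2 (Matrix.vecMul p.1 γ.1) := by
  by_contra! hcon
  have h : ∀ v : Fin 2 → ZMod N, v 0 = 1 → v = Matrix.vecMul v γ.1 := fun v hv =>
    WW_sep N hv (hcon (v, 3) le_rfl) (hcon (v, 4) (by norm_num))
  have h1 := h ![1, 0] rfl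
  have h2 := h ![1, 1] rfl
  have a0 := congrFun h1 0
  have a1 := congrFun h1 1
  have b0 := congrFun h2 0
  have b1 := congrFun h2 1
  simp [Matrix.vecMul, dotProduct, Fin.sum_univ_two] at a0 a1 b0 b1
  apply hγ
  ext i j
  fin_cases i <;> fin_cases j
  · exact a0.symm
  · exact a1.symm
  · simp; linear_combination a0 - b0
  · simp; linear_combination a1 - b1
end Eis

section MainArg
open ModularForm
open scoped Manifold

lemma exists_level_one {F : ℍ → ℂ} {k : ℤ}
    (hinv : ∀ (γ : SL(2, ℤ)) (τ : ℍ), F (γ • τ) = denom γ τ ^ k * F τ) (hF : MDiff F)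
    (hb : IsBoundedAtImInfty F) : ∃ g : ModularForm 𝒮ℒ k, ⇑g = F := by
  have hs : ∀ γ : SL(2, ℤ), F ∣[k] γ = F := fun γ => by
    funext τ
    rw [SL_slash_apply, hinv, zpow_neg, mul_comm, inv_mul_cancel_left₀]
    exact zpow_ne_zero _ (denom_ne_zero _ _)
  refine ⟨{ toFun := F, slash_action_eq' := ?_, holo' := hF, bdd_at_cusps' := ?_ }, rfl⟩
  · rintro _ ⟨γ, rfl⟩
    exact hs γ
  · intro c hc
    rw [OnePoint.isBoundedAt_iff_forall_SL2Z hc]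
    intro γ _
    rw [hs]; exact hb

lemma level_one_smul {k : ℤ} (g : ModularForm 𝒮ℒ k) (γ : SL(2, ℤ)) (τ : ℍ) :
    g (γ • τ) = denom γ τ ^ k * g τ := by
  have h : ⇑g ∣[k] γ = ⇑g := SlashInvariantForm.slash_action_eqn g _ ⟨γ, rfl⟩
  have h2 := congrFun h τ
  rw [SL_slash_apply] at h2
  rw [← h2, zpow_neg, mul_comm, inv_mul_cancel_right₀]
  exact zpow_ne_zero _ (denom_ne_zero _ _)

/-- The finite quotient. -/
abbrev GG (N : ℕ) := (rho N).range

instance (N : ℕ) [NeZero N] : Fintype (GG N) := Fintype.ofFinite _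

/-- reduction to the finite group. -/
def rr (N : ℕ) : SL(2, ℤ) →* GG N := (rho N).rangeRestrict

lemma rr_surj (N : ℕ) : Function.Surjective (rr N) := MonoidHom.rangeRestrict_surjective _

lemma rr_coe (N : ℕ) (γ : SL(2, ℤ)) : ((rr N γ : GG N) : SL(2, ZMod N)) = rho N γ := rfl

/-- translates of `f`. -/
def fd {N : ℕ} {k : ℤ} (f : ModularForm (CongruenceSubgroup.Gamma N) k) (δ : GG N) : ℍ → ℂ :=
  ⇑f ∣[k] (rr_surj N δ).choose

lemma fd_rr {N : ℕ} {k : ℤ} (f : ModularForm (CongruenceSubgroup.Gamma N) k) (g : SL(2, ℤ)) :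
    fd f (rr N g) = ⇑f ∣[k] g := by
  have h := (rr_surj N (rr N g)).choose_spec
  rw [fd]
  generalize (rr_surj N (rr N g)).choose = x at h
  have hx : x * g⁻¹ ∈ CongruenceSubgroup.Gamma N := by
    have : rho N x = rho N g := congrArg Subtype.val h
    show rho N (x * g⁻¹) = 1
    rw [map_mul, this, ← map_mul]; simp
  have h2 : ⇑f ∣[k] (x * g⁻¹) = ⇑f :=
    SlashInvariantForm.slash_action_eqn f _ (Subgroup.mem_map_of_mem _ hx)
  rw [show x = (x * g⁻¹) * g by group, SlashAction.slash_mul, h2]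

lemma fd_smul {N : ℕ} {k : ℤ} (f : ModularForm (CongruenceSubgroup.Gamma N) k) (δ : GG N)
    (g : SL(2, ℤ)) (τ : ℍ) : fd f δ (g • τ) = denom g τ ^ k * fd f (δ * rr N g) τ := by
  obtain ⟨x, rfl⟩ := rr_surj N δ
  rw [← map_mul, fd_rr, fd_rr, SlashAction.slash_mul, SL_slash_apply _ g, zpow_neg, mul_comm,
    inv_mul_cancel_right₀]
  exact zpow_ne_zero _ (denom_ne_zero _ _)

lemma fd_mdiff {N : ℕ} {k : ℤ} (f : ModularForm (CongruenceSubgroup.Gamma N) k) (δ : GG N) :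
    MDiff (fd f δ) :=
  MDifferentiable.slash f.holo' k _

lemma fd_bdd {N : ℕ} [NeZero N] {k : ℤ} (f : ModularForm (CongruenceSubgroup.Gamma N) k) (δ : GG N) :
    IsBoundedAtImInfty (fd f δ) :=
  ModularFormClass.bdd_at_infty_slash f _

lemma bdd_sum {ι : Type*} (s : Finset ι) {F : ι → ℍ → ℂ} (h : ∀ i ∈ s, IsBoundedAtImInfty (F i)) :
    IsBoundedAtImInfty (fun τ => ∑ i ∈ s, F i τ) := by
  classical
  induction s using Finset.induction_on with
  | empty => simpa using! zero_form_isBoundedAtImInfty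
  | insert a s ha ih =>
    simp only [Finset.sum_insert ha]
    exact Filter.BoundedAtFilter.add (h a (by simp)) (ih fun i hi => h i (by simp [hi]))

lemma mdiff_sum {ι : Type*} (s : Finset ι) {F : ι → ℍ → ℂ} (h : ∀ i ∈ s, MDiff (F i)) :
    MDiff (fun τ => ∑ i ∈ s, F i τ) := by
  classical
  induction s using Finset.induction_on with
  | empty => simpa using mdifferentiable_const
  | insert a s ha ih =>
    simp only [Finset.sum_insert ha]
    exact MDifferentiable.add (h a (by simp)) (ih fun i hi => h i (by simp [hi]))

/-- Translates of the Eisenstein series. -/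
def ws (N : ℕ) (p : GG N → (Fin 2 → ZMod N) × ℕ) (γ δ : GG N) : ℍ → ℂ :=
  WW N (p γ).2 (Matrix.vecMul (p γ).1 δ.1.1)

lemma ws_smul (N : ℕ) (p : GG N → (Fin 2 → ZMod N) × ℕ) (γ δ : GG N) (g : SL(2, ℤ)) (τ : ℍ) :
    ws N p γ δ (g • τ) = denom g τ ^ (p γ).2 * ws N p γ (δ * rr N g) τ := by
  rw [ws, WW_smul, Matrix.vecMul_vecMul]; rfl

/-- The level one coefficient forms. -/
def gS {N : ℕ} [NeZero N] {k : ℤ} (f : ModularForm (CongruenceSubgroup.Gamma N) k)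
    (p : GG N → (Fin 2 → ZMod N) × ℕ) (T : Finset (GG N)) (τ : ℍ) : ℂ :=
  ∑ δ : GG N, fd f δ τ * ∏ γ ∈ T, (- ws N p γ (γ * δ) τ)

lemma gS_form {N : ℕ} [NeZero N] {k : ℤ} (f : ModularForm (CongruenceSubgroup.Gamma N) k)
    (p : GG N → (Fin 2 → ZMod N) × ℕ) (T : Finset (GG N)) (hp : ∀ γ ∈ T, 3 ≤ (p γ).2) :
    ∃ g : ModularForm 𝒮ℒ (k + (∑ γ ∈ T, (p γ).2 : ℕ)), ⇑g = gS f p T := by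
  have hN1 : 1 ≤ N := Nat.pos_of_neZero N
  have hP : ∀ δ, ∃ P, HP N (fun τ => ∏ γ ∈ T, (- ws N p γ (γ * δ) τ)) P := fun δ =>
    ⟨_, HP.prod T fun γ hγ => (WW_HP N (hp γ hγ) _).neg⟩
  apply exists_level_one
  · intro g τ
    have h1 : ∀ δ : GG N, fd f δ (g • τ) * ∏ γ ∈ T, (- ws N p γ (γ * δ) (g • τ)) =
        denom g τ ^ (k + (∑ γ ∈ T, (p γ).2 : ℕ)) * (fd f (δ * rr N g) τ *
          ∏ γ ∈ T, (- ws N p γ (γ * (δ * rr N g)) τ)) := fun δ => by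
      rw [fd_smul, zpow_add₀ (denom_ne_zero _ _), zpow_natCast, ← Finset.prod_pow_eq_pow_sum]
      simp only [ws_smul, mul_assoc, ← mul_neg, Finset.prod_mul_distrib]
      ring
    rw [gS, gS, Finset.mul_sum]
    simp_rw [h1]
    exact Equiv.sum_comp (Equiv.mulRight (rr N g)) fun δ => denom g τ ^ (k + (∑ γ ∈ T, (p γ).2 : ℕ)) *
      (fd f δ τ * ∏ γ ∈ T, (- ws N p γ (γ * δ) τ))
  · refine mdiff_sum _ fun δ _ => ?_
    obtain ⟨P, hP⟩ := hP δ
    exact MDifferentiable.mul (fd_mdiff f δ) hP.mdiff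
  · refine bdd_sum _ fun δ _ => ?_
    obtain ⟨P, hP⟩ := hP δ
    exact Filter.BoundedAtFilter.mul (fd_bdd f δ) (hP.bdd hN1)

open Classical in
lemma main_identity {N : ℕ} [NeZero N] {k : ℤ} (f : ModularForm (CongruenceSubgroup.Gamma N) k)
    (p : GG N → (Fin 2 → ZMod N) × ℕ) (g : GG N) (τ : ℍ) :
    fd f g τ * ∏ γ ∈ Finset.univ.erase (1 : GG N), (ws N p γ g τ - ws N p γ (γ * g) τ) =
    ∑ S ∈ (Finset.univ.erase (1 : GG N)).powerset, (∏ γ ∈ S, ws N p γ g τ) *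
      gS f p (Finset.univ.erase (1 : GG N) \ S) τ := by
  have h1 : fd f g τ * ∏ γ ∈ Finset.univ.erase (1 : GG N), (ws N p γ g τ - ws N p γ (γ * g) τ) =
      ∑ δ : GG N, fd f δ τ *
        ∏ γ ∈ Finset.univ.erase (1 : GG N), (ws N p γ g τ - ws N p γ (γ * δ) τ) := by
    rw [Finset.sum_eq_single g]
    · intro δ _ hδ
      rw [Finset.prod_eq_zero (i := g * δ⁻¹), mul_zero]
      · simp only [Finset.mem_erase, Finset.mem_univ, and_true, ne_eq]
        intro h
        exact hδ (mul_inv_eq_one.mp h).symm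
      · simp
    · simp
  rw [h1]
  simp only [sub_eq_add_neg, Finset.prod_add, Finset.mul_sum, gS]
  rw [Finset.sum_comm]
  refine Finset.sum_congr rfl fun S _ => Finset.sum_congr rfl fun δ _ => ?_
  ring


open Classical in
lemma main_thm (N : ℕ) [NeZero N] (k : ℤ)
    (f h : ModularForm (CongruenceSubgroup.Gamma N) k)
    (s : ℂ ≃+* ℂ) (l l' : ℤ)
    (hs : s (zetaC N) = zetaC N ^ l)
    (hl : (l : ZMod N) * (l' : ZMod N) = 1)
    (hfh : SRel N s f h) (g glam : SL(2, ℤ))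
    (hg00 : ((glam 0 0 : ℤ) : ZMod N) = ((g 0 0 : ℤ) : ZMod N))
    (hg01 : ((glam 0 1 : ℤ) : ZMod N) = (l : ZMod N) * ((g 0 1 : ℤ) : ZMod N))
    (hg10 : ((glam 1 0 : ℤ) : ZMod N) = (l' : ZMod N) * ((g 1 0 : ℤ) : ZMod N))
    (hg11 : ((glam 1 1 : ℤ) : ZMod N) = ((g 1 1 : ℤ) : ZMod N))
    {pc pc' : PowerSeries ℂ} (hc : HP N (⇑f ∣[k] g) pc) (hc' : HP N (⇑h ∣[k] glam) pc') :
    pc' = pc.map (s : ℂ →+* ℂ) := by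
  have hN1 : 1 ≤ N := Nat.pos_of_neZero N
  -- choice of separating Eisenstein series
  have hsep : ∀ γ : GG N, ∃ p : (Fin 2 → ZMod N) × ℕ, 3 ≤ p.2 ∧
      (γ ≠ 1 → WW N p.2 p.1 ≠ WW N p.2 (Matrix.vecMul p.1 γ.1.1)) := fun γ => by
    by_cases hγ : γ = 1
    · exact ⟨(0, 3), le_rfl, fun h => absurd hγ h⟩
    · obtain ⟨p, hp, hp'⟩ := WW_sep' N γ.1 (fun h => hγ (Subtype.ext h))
      exact ⟨p, hp, fun _ => hp'⟩
  choose p hp3 hpne using hsep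
  set E : Finset (GG N) := Finset.univ.erase (1 : GG N) with hE
  let dd : (Fin 2 → ZMod N) → (Fin 2 → ZMod N) := fun v => ![v 0, l * v 1]
  let w' : GG N → GG N → ℍ → ℂ := fun γ δ => WW N (p γ).2 (dd (Matrix.vecMul (p γ).1 δ.1.1))
  have hw' : ∀ γ δ, SRel N s (ws N p γ δ) (w' γ δ) := fun γ δ => WW_SRel N hs (hp3 γ) _
  have hdd : ∀ v : Fin 2 → ZMod N, Matrix.vecMul (dd v) (rho N glam).1 =
      dd (Matrix.vecMul v (rho N g).1) := fun v => by
    have e : ∀ (x : SL(2, ℤ)) i j, (rho N x).1 i j = ((x i j : ℤ) : ZMod N) := fun x i j => rfl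
    funext i
    fin_cases i
    · simp [dd, Matrix.vecMul, dotProduct, Fin.sum_univ_two, e, hg00, hg10]
      linear_combination v 1 * ((g 1 0 : ℤ) : ZMod N) * hl
    · simp [dd, Matrix.vecMul, dotProduct, Fin.sum_univ_two, e, hg01, hg11]
      ring
  have hw'smul : ∀ γ δ (τ : ℍ), w' γ δ (glam • τ) =
      denom glam τ ^ (p γ).2 * w' γ (δ * rr N g) τ := fun γ δ τ => by
    simp only [w']
    rw [WW_smul, hdd, Matrix.vecMul_vecMul]; rfl
  -- level one forms
  have hgS : ∀ T : Finset (GG N), ∃ G : ModularForm 𝒮ℒ (k + (∑ γ ∈ T, (p γ).2 : ℕ)),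
      SRel N s (gS f p T) G := fun T => by
    obtain ⟨G, hG⟩ := gS_form f p T fun γ _ => hp3 γ
    rw [← hG]
    exact SRel_level_one' hN1 s G
  choose G' hG' using hgS
  have hR : ∀ δ : GG N, SRel N s
      (fun τ => fd f δ τ * ∏ γ ∈ E, (ws N p γ δ τ - ws N p γ (γ * δ) τ))
      (fun τ => ∑ S ∈ E.powerset, (∏ γ ∈ S, w' γ δ τ) * G' (E \ S) τ) := fun δ => by
    refine (SRel.sum E.powerset fun S _ =>
      (SRel.prod S fun γ _ => hw' γ δ).mul (hG' (E \ S))).congr (fun τ => ?_) (fun τ => rfl)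
    exact (main_identity f p δ τ).symm
  have hDD : ∀ δ : GG N, SRel N s (fun τ => ∏ γ ∈ E, (ws N p γ δ τ - ws N p γ (γ * δ) τ))
      (fun τ => ∏ γ ∈ E, (w' γ δ τ - w' γ (γ * δ) τ)) := fun δ =>
    SRel.prod E fun γ _ => (hw' γ δ).sub (hw' γ (γ * δ))
  have hf1 : fd f (1 : GG N) = f := by
    rw [← map_one (rr N), fd_rr, SlashAction.slash_one]
  have hone : (fun τ => h τ * ∏ γ ∈ E, (w' γ 1 τ - w' γ (γ * 1) τ)) =
      (fun τ => ∑ S ∈ E.powerset, (∏ γ ∈ S, w' γ 1 τ) * G' (E \ S) τ) := by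
    refine SRel.fun_unique hN1 ((hfh.mul (hDD 1)).congr (fun τ => ?_) (fun τ => rfl)) (hR 1)
    rw [hf1]
  have hglam : ∀ τ : ℍ, (⇑h ∣[k] glam) τ * ∏ γ ∈ E, (w' γ (rr N g) τ - w' γ (γ * rr N g) τ) =
      ∑ S ∈ E.powerset, (∏ γ ∈ S, w' γ (rr N g) τ) * G' (E \ S) τ := fun τ => by
    have h1 := congrFun hone (glam • τ)
    have hd := denom_ne_zero glam τ
    have hden : denom glam τ ^ (k + (∑ γ ∈ E, (p γ).2 : ℕ)) ≠ 0 := zpow_ne_zero _ hd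
    refine mul_left_cancel₀ hden ?_
    have hh : h (glam • τ) = denom glam τ ^ k * (⇑h ∣[k] glam) τ := by
      rw [SL_slash_apply, zpow_neg, mul_comm, inv_mul_cancel_right₀]
      exact zpow_ne_zero _ hd
    simp only [hh, hw'smul, level_one_smul, ← mul_sub, Finset.prod_mul_distrib,
      Finset.prod_pow_eq_pow_sum, one_mul, mul_one] at h1
    rw [Finset.mul_sum]
    convert h1 using 1
    · rw [zpow_add₀ hd, zpow_natCast]; ring
    · refine Finset.sum_congr rfl fun S hS => ?_
      rw [← Finset.sum_sdiff (Finset.mem_powerset.mp hS)]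
      push_cast
      rw [← add_assoc, zpow_add₀ hd (_ + _)]
      simp only [← Nat.cast_sum, zpow_natCast]
      ring
  refine SRel.cancel hN1 hc hc' (hDD (rr N g)) ?_ ((hR (rr N g)).congr (fun τ => ?_) fun τ => ?_)
  · -- nonvanishing
    intro h0
    have hq : ∀ γ, HP N (fun τ => ws N p γ (rr N g) τ - ws N p γ (γ * rr N g) τ)
      (PowerSeries.mk (ee N (p γ).2 (Matrix.vecMul (p γ).1 (rr N g).1.1 0)
          (Matrix.vecMul (p γ).1 (rr N g).1.1 1)) -
        PowerSeries.mk (ee N (p γ).2 (Matrix.vecMul (p γ).1 (γ * rr N g).1.1 0)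
          (Matrix.vecMul (p γ).1 (γ * rr N g).1.1 1))) := fun γ =>
      (WW_HP N (hp3 γ) _).sub (WW_HP N (hp3 γ) _)
    have hprod := HP.prod E fun γ _ => hq γ
    rw [h0] at hprod
    obtain ⟨γ, hγ, hz⟩ := Finset.prod_eq_zero_iff.mp (hprod.eq_zero hN1)
    have hq' := hq γ
    rw [hz] at hq'
    refine hpne γ (Finset.ne_of_mem_erase hγ) (funext fun τ => ?_)
    have h2 : ∀ τ, ws N p γ (rr N g) τ - ws N p γ (γ * rr N g) τ = 0 := fun τ => by
      have := (hq' τ).tsum_eq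
      simpa using this.symm
    have a1 := ws_smul N p γ 1 g (g⁻¹ • τ)
    have a2 := ws_smul N p γ γ g (g⁻¹ • τ)
    rw [one_mul, sub_eq_zero.mp (h2 _), ← a2, smul_inv_smul] at a1
    simpa [ws] using a1
  · rw [fd_rr]
  · exact (hglam τ).symm
end MainArg

/-- Let `f, h` be modular forms of weight `k ≥ 1` on `Γ(N)`, `σ` a field
automorphism of `ℂ` with `σ(ζ_N) = ζ_N^λ`, `λλ' ≡ 1 (mod N)`, and suppose the Fourier
coefficients of `h` are the `σ`-images of those of `f`. If `g = (A,B;C,D) ∈ SL₂(ℤ)` and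
`g_λ ≡ (A, λB; λ'C, D) (mod N)`, then applying `σ` to the Fourier coefficients of `f|_k g`
yields the Fourier coefficients of `h|_k g_λ`. -/
theorem stmt_2 (N : ℕ) (hN : 1 ≤ N) (k : ℤ) (hk : 1 ≤ k)
    (f h : ModularForm (Gamma N) k)
    (σ : ℂ ≃+* ℂ) (lam lam' : ℤ) (hlam : IsCoprime lam (N : ℤ))
    (hσ : σ (zetaC N) = zetaC N ^ lam)
    (hlam' : lam * lam' ≡ 1 [ZMOD (N : ℤ)])
    (cf ch : ℕ → ℂ)
    (hcf : HasExpansion N (⇑f) cf) (hch : HasExpansion N (⇑h) ch)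
    (hfh : ∀ n : ℕ, ch n = σ (cf n))
    (g glam : SL(2, ℤ))
    (hg00 : ((glam 0 0 : ℤ) : ZMod N) = ((g 0 0 : ℤ) : ZMod N))
    (hg01 : ((glam 0 1 : ℤ) : ZMod N) = (lam : ZMod N) * ((g 0 1 : ℤ) : ZMod N))
    (hg10 : ((glam 1 0 : ℤ) : ZMod N) = (lam' : ZMod N) * ((g 1 0 : ℤ) : ZMod N))
    (hg11 : ((glam 1 1 : ℤ) : ZMod N) = ((g 1 1 : ℤ) : ZMod N))
    (c c' : ℕ → ℂ)
    (hc : HasExpansion N (⇑f ∣[k] g) c)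
    (hc' : HasExpansion N (⇑h ∣[k] glam) c') :
    ∀ n : ℕ, c' n = σ (c n) := by
  haveI : NeZero N := ⟨by omega⟩
  have hl : (lam : ZMod N) * (lam' : ZMod N) = 1 := by
    have := (ZMod.intCast_eq_intCast_iff _ _ N).mpr hlam'
    simpa using this
  have hS : SRel N σ f h := by
    refine ⟨_, (HP_iff _ _ _).mp hcf, ?_⟩
    convert (HP_iff _ _ _).mp hch using 1
    ext n
    simp [hfh]
  have := main_thm N k f h σ lam lam' hσ hl hS g glam hg00 hg01 hg10 hg11
    ((HP_iff _ _ _).mp hc) ((HP_iff _ _ _).mp hc')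
  intro n
  simpa using congrArg (PowerSeries.coeff n) this
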